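/- Let T be a pruned order tree. Then the ray space R(T) is compact if and only if every node of T has only finitely many successors. -/

import Mathlib

open Set Topology

universe u v

/-- An order tree: a partial order with a minimum element (the root) in which
the set of predecessors of every element is a well-ordered chain. -/
def IsOrderTree (T : Type u) [PartialOrder T] : Prop :=
  (∃ r : T, ∀ t : T, r ≤ t) ∧
    ∀ t : T, IsChain (· ≤ ·) (Set.Iic t) ∧ (Set.Iic t).IsWF

/-- A tree is special if it is the union of countably many antichains. -/
def IsSpecialTree (T : Type u) [PartialOrder T] : Prop :=
  ∃ A : ℕ → Set T, (∀ n, IsAntichain (· ≤ ·) (A n)) ∧ (⋃ n, A n) = Set.univ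

/-- A path of `T`: a down-closed chain. -/
def IsPath {T : Type u} [PartialOrder T] (x : Set T) : Prop :=
  IsChain (· ≤ ·) x ∧ ∀ ⦃s t : T⦄, s ≤ t → t ∈ x → s ∈ x

/-- A ray: a path with no maximal element. -/
def IsRay {T : Type u} [PartialOrder T] (x : Set T) : Prop :=
  IsPath x ∧ ∀ t ∈ x, ∃ s ∈ x, t < s

/-- A branch: an inclusion-wise maximal path. -/
def IsBranch {T : Type u} [PartialOrder T] (x : Set T) : Prop :=
  IsPath x ∧ ∀ y : Set T, IsPath y → x ⊆ y → y = x

/-- The product topology of `2^T`, transported to `Set T` via characteristic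
functions: it is generated by the sets `{s | t ∈ s}` and their complements. -/
def cylinderTopology (T : Type u) : TopologicalSpace (Set T) :=
  TopologicalSpace.generateFrom
    {C : Set (Set T) | ∃ t : T, C = {s : Set T | t ∈ s} ∨ C = {s : Set T | t ∉ s}}

/-- The path space `P(T)`. -/
def PathSpace (T : Type u) [PartialOrder T] : Type u := {x : Set T // IsPath x}

/-- The ray space `R(T)`. -/
def RaySpace (T : Type u) [PartialOrder T] : Type u := {x : Set T // IsRay x}

/-- The branch space `B(T)`. -/
def BranchSpace (T : Type u) [PartialOrder T] : Type u := {x : Set T // IsBranch x}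

instance PathSpace.topologicalSpace (T : Type u) [PartialOrder T] :
    TopologicalSpace (PathSpace T) :=
  TopologicalSpace.induced (fun x => x.1) (cylinderTopology T)

instance RaySpace.topologicalSpace (T : Type u) [PartialOrder T] :
    TopologicalSpace (RaySpace T) :=
  TopologicalSpace.induced (fun x => x.1) (cylinderTopology T)

instance BranchSpace.topologicalSpace (T : Type u) [PartialOrder T] :
    TopologicalSpace (BranchSpace T) :=
  TopologicalSpace.induced (fun x => x.1) (cylinderTopology T)

/-- The subbasic set `[t] = {x ∈ R(T) : t ∈ x}`. -/
def raySet {T : Type u} [PartialOrder T] (t : T) : Set (RaySpace T) := {x | t ∈ x.1}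

/-- The basic set `[t] = {x ∈ B(T) : t ∈ x}`. -/
def branchSet {T : Type u} [PartialOrder T] (t : T) : Set (BranchSpace T) := {x | t ∈ x.1}

/-- A top of a ray `x` is a node whose set of strict predecessors is exactly `x`. -/
def IsTopOf {T : Type u} [PartialOrder T] (t : T) (x : Set T) : Prop := Set.Iio t = x

/-- `s` is a successor of `t`. -/
def IsSuccessorOf {T : Type u} [PartialOrder T] (s t : T) : Prop :=
  t < s ∧ ∀ u : T, t < u → u < s → False

/-- A tree is pruned if every node has a successor. -/
def IsPruned (T : Type u) [PartialOrder T] : Prop := ∀ t : T, ∃ s : T, IsSuccessorOf s t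

/-- A family of sets is nested if any two intersecting members are ⊆-comparable. -/
def NestedFam {X : Type v} (𝒜 : Set (Set X)) : Prop :=
  ∀ A ∈ 𝒜, ∀ B ∈ 𝒜, (A ∩ B).Nonempty → A ⊆ B ∨ B ⊆ A

/-- A family of sets is noetherian if every ⊆-increasing sequence of its members
is eventually constant. -/
def NoetherianFam {X : Type v} (𝒜 : Set (Set X)) : Prop :=
  ∀ f : ℕ → Set X, (∀ n, f n ∈ 𝒜) → Monotone f → ∃ N, ∀ n, N ≤ n → f n = f N

/-- A family of sets is centered if every finite subfamily has nonempty intersection. -/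
def CenteredFam {X : Type v} (𝒜 : Set (Set X)) : Prop :=
  ∀ F : Finset (Set X), ↑F ⊆ 𝒜 → (⋂₀ (F : Set (Set X))).Nonempty

/-- A family of sets is complete if every centered subfamily has nonempty intersection. -/
def CompleteFam {X : Type v} (𝒜 : Set (Set X)) : Prop :=
  ∀ 𝒞 ⊆ 𝒜, CenteredFam 𝒞 → (⋂₀ 𝒞).Nonempty

/-- A family is hereditarily complete if its trace on every closed set is complete. -/
def HeredCompleteFam {X : Type v} [TopologicalSpace X] (𝒜 : Set (Set X)) : Prop :=
  ∀ Y : Set X, IsClosed Y → CompleteFam {B : Set X | ∃ A ∈ 𝒜, B = A ∩ Y}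

/-- A family is σ-disjoint if it is a countable union of pairwise disjoint subfamilies. -/
def SigmaDisjointFam {X : Type v} (𝒜 : Set (Set X)) : Prop :=
  ∃ D : ℕ → Set (Set X), (∀ n, (D n).Pairwise Disjoint) ∧ (⋃ n, D n) = 𝒜

/-- `S` is a clopen subbase for `X` if the topology of `X` is the coarsest one in which
every member of `S` is clopen, i.e. it is generated by `S` together with the complements
of members of `S`. -/
def IsClopenSubbase {X : Type v} [t : TopologicalSpace X] (S : Set (Set X)) : Prop :=
  t = TopologicalSpace.generateFrom (S ∪ {B : Set X | ∃ A ∈ S, B = Aᶜ})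

/-- `B` is a base for the topology of `X`. -/
def IsBaseFam {X : Type v} [TopologicalSpace X] (B : Set (Set X)) : Prop :=
  (∀ U ∈ B, IsOpen U) ∧ ∀ U : Set X, IsOpen U → ∀ x ∈ U, ∃ V ∈ B, x ∈ V ∧ V ⊆ U

theorem IsOrderTree.exists_successor_le {T : Type u} [PartialOrder T] (hT : IsOrderTree T)
    {t s : T} (h : t < s) : ∃ u, IsSuccessorOf u t ∧ u ≤ s := by
  have hwf : (Set.Ioc t s).IsWF := (hT.2 s).2.mono fun _ hu => hu.2
  have hne : (Set.Ioc t s).Nonempty := ⟨s, h, le_rfl⟩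
  have hmin := hwf.min_mem hne
  refine ⟨hwf.min hne, ⟨hmin.1, fun u htu hu => ?_⟩, hmin.2⟩
  exact hwf.not_lt_min hne ⟨htu, hu.le.trans hmin.2⟩ hu

theorem IsRay.exists_successor_mem {T : Type u} [PartialOrder T] (hT : IsOrderTree T)
    {x : Set T} (hx : IsRay x) {t : T} (ht : t ∈ x) : ∃ s, IsSuccessorOf s t ∧ s ∈ x := by
  obtain ⟨s, hs, hts⟩ := hx.2 t ht
  obtain ⟨u, hu, hus⟩ := hT.exists_successor_le hts
  exact ⟨u, hu, hx.1.2 hus hs⟩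

theorem IsSuccessorOf.eq_of_le {T : Type u} [PartialOrder T] {s s' t : T}
    (hs : IsSuccessorOf s t) (hs' : IsSuccessorOf s' t) (h : s ≤ s') : s = s' :=
  h.eq_or_lt.resolve_right fun hlt => hs'.2 s hs.1 hlt

theorem IsPath.successor_unique {T : Type u} [PartialOrder T] {x : Set T} (hx : IsPath x)
    {s s' t : T} (hs : IsSuccessorOf s t) (hs' : IsSuccessorOf s' t)
    (hsx : s ∈ x) (hsx' : s' ∈ x) : s = s' :=
  (hx.1.total hsx hsx').elim (hs.eq_of_le hs') fun h => (hs'.eq_of_le hs h).symm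

theorem IsPruned.exists_ray {T : Type u} [PartialOrder T] (hp : IsPruned T)
    (hT : IsOrderTree T) (s : T) : ∃ x : RaySpace T, s ∈ x.1 := by
  choose f hf using hp
  have hlt : ∀ n, f^[n] s < f^[n + 1] s := fun n => by
    rw [Function.iterate_succ_apply']
    exact (hf _).1
  have hmono : Monotone fun n => f^[n] s := monotone_nat_of_le_succ fun n => (hlt n).le
  refine ⟨⟨{u | ∃ n, u ≤ f^[n] s}, ⟨?_, fun u v huv ⟨n, hn⟩ => ⟨n, huv.trans hn⟩⟩, ?_⟩,
    0, le_rfl⟩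
  · rintro u ⟨m, hm⟩ v ⟨n, hn⟩ huv
    exact (hT.2 (f^[max m n] s)).1 (hm.trans (hmono (le_max_left m n)))
      (hn.trans (hmono (le_max_right m n))) huv
  · rintro u ⟨n, hn⟩
    exact ⟨f^[n + 1] s, ⟨n + 1, le_rfl⟩, hn.trans_lt (hlt n)⟩

theorem isOpen_raySet {T : Type u} [PartialOrder T] (t : T) : IsOpen (raySet t) :=
  let _ := cylinderTopology T
  isOpen_induced_iff.2
    ⟨{s | t ∈ s}, TopologicalSpace.isOpen_generateFrom_of_mem ⟨t, .inl rfl⟩, rfl⟩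

theorem isOpen_compl_raySet {T : Type u} [PartialOrder T] (t : T) : IsOpen (raySet t)ᶜ :=
  let _ := cylinderTopology T
  isOpen_induced_iff.2
    ⟨{s | t ∉ s}, TopologicalSpace.isOpen_generateFrom_of_mem ⟨t, .inr rfl⟩, rfl⟩

theorem RaySpace.tendsto_nhds {T : Type u} [PartialOrder T] {F : Filter (RaySpace T)}
    {x : RaySpace T} (hmem : ∀ t ∈ x.1, ∀ᶠ y in F, t ∈ y.1)
    (hnot : ∀ t ∉ x.1, ∀ᶠ y in F, t ∉ y.1) : F ≤ 𝓝 x := by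
  let _ := cylinderTopology T
  rw [nhds_induced, ← Filter.tendsto_iff_comap]
  refine TopologicalSpace.tendsto_nhds_generateFrom_iff.2 ?_
  rintro C ⟨t, rfl | rfl⟩ hx
  · exact hmem t hx
  · exact hnot t hx

theorem RaySpace.compactSpace {T : Type u} [PartialOrder T] (hT : IsOrderTree T)
    (hfin : ∀ t : T, {s : T | IsSuccessorOf s t}.Finite) : CompactSpace (RaySpace T) := by
  refine ⟨isCompact_iff_ultrafilter_le_nhds.2 fun F _ => ?_⟩
  let x : Set T := {t | ∀ᶠ y in F, t ∈ (y : RaySpace T).1}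
  have hx : IsRay x := by
    refine ⟨⟨fun s hs t ht hst => ?_, fun s t hst ht => ?_⟩, fun t ht => ?_⟩
    · obtain ⟨y, hys, hyt⟩ := (Filter.Eventually.and hs ht).exists
      exact y.2.1.1 hys hyt hst
    · exact Filter.Eventually.mono ht fun y hy => y.2.1.2 hst hy
    · have hsucc : (⋃ s ∈ {s | IsSuccessorOf s t}, raySet s) ∈ F := by
        filter_upwards [ht] with y hy
        obtain ⟨s, hs, hsy⟩ := y.2.exists_successor_mem hT hy
        exact Set.mem_biUnion hs hsy
      obtain ⟨s, hs, hsF⟩ := (Ultrafilter.finite_biUnion_mem_iff (hfin t)).1 hsucc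
      exact ⟨s, hsF, hs.1⟩
  exact ⟨⟨x, hx⟩, Set.mem_univ _,
    RaySpace.tendsto_nhds (fun _ ht => ht) fun _ ht => Ultrafilter.eventually_not.2 ht⟩

theorem RaySpace.finite_successors {T : Type u} [PartialOrder T] (hT : IsOrderTree T)
    (hp : IsPruned T) [CompactSpace (RaySpace T)] (t : T) :
    {s : T | IsSuccessorOf s t}.Finite := by
  have hcompact : IsCompact (raySet t) :=
    (isOpen_compl_iff.1 (isOpen_compl_raySet t)).isCompact
  obtain ⟨b, hb, hbfin, hcover⟩ := hcompact.elim_finite_subcover_image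
    (b := {s | IsSuccessorOf s t}) (c := raySet) (fun s _ => isOpen_raySet s) fun x hx => by
      obtain ⟨s, hs, hsx⟩ := x.2.exists_successor_mem hT hx
      exact Set.mem_biUnion hs hsx
  refine hbfin.subset fun s hs => ?_
  obtain ⟨x, hx⟩ := hp.exists_ray hT s
  obtain ⟨s', hs', hx'⟩ := Set.mem_iUnion₂.1 (hcover (x.2.1.2 hs.1.le hx))
  exact x.2.1.successor_unique hs (hb hs') hx hx' ▸ hs'

/-- For a pruned order tree `T`, the ray space `R(T)` is compact iff every
node of `T` has only finitely many successors. -/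
theorem stmt8 {T : Type u} [PartialOrder T] (hT : IsOrderTree T) (hp : IsPruned T) :
    CompactSpace (RaySpace T) ↔ ∀ t : T, {s : T | IsSuccessorOf s t}.Finite := by
  exact ⟨fun _ => RaySpace.finite_successors hT hp, RaySpace.compactSpace hT⟩
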